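/- Define the length ℓ on a generalised Renner monoid R by ℓ(s)=1 for s ∈ S, ℓ(e)=0 for e ∈ Λ, extended to words additively and to elements as the minimum over representing words on S ∪ (Λ∖{1}). If (w₁, e, w₂) is the normal decomposition of r ∈ R, then ℓ(r) = ℓ(w₁) + ℓ(w₂), where on the right ℓ denotes the Coxeter length in the unit group W. -/

import Mathlib

noncomputable section

/-- A generalised Renner–Coxeter system on a monoid `R`: a Coxeter system `(Rˣ, S)` on the unit
group (indexed by `B`, with data `cm`, `cs`), a cross-section semilattice `Λ` of idempotents,
and type maps `lam = λ`, `lamStar = λ_⋆` satisfying axioms (ECS1)–(ECS6). -/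
structure GRCSystem (B : Type*) (R : Type*) [Monoid R] where
  /-- The Coxeter matrix indexing the simple reflections `S`. -/
  cm : CoxeterMatrix B
  /-- (ECS3): the unit group of `R` is a Coxeter group. -/
  cs : CoxeterSystem cm Rˣ
  /-- The cross-section lattice `Λ`. -/
  Λ : Set R
  /-- The type map `λ`, with `W(e) = W_{λ(e)}`. -/
  lam : R → Set B
  /-- The map `λ_⋆`, with `W_⋆(e) = W_{λ_⋆(e)}`. -/
  lamStar : R → Set B
  /-- (ECS1): idempotents commute, i.e. `E(R)` is a (lower) semilattice. -/
  idem_mul_comm : ∀ e f : R, IsIdempotentElem e → IsIdempotentElem f → e * f = f * e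
  /-- (ECS1): `R` is unit regular (factorisable). -/
  factor : ∀ r : R, ∃ (e : R) (g : Rˣ), IsIdempotentElem e ∧ r = e * (g : R)
  /-- (ECS2): elements of `Λ` are idempotent. -/
  lam_idem : ∀ e ∈ Λ, IsIdempotentElem e
  /-- (ECS2): `Λ` is a sub-semilattice of `E(R)`. -/
  lam_mul_mem : ∀ e ∈ Λ, ∀ f ∈ Λ, e * f ∈ Λ
  /-- (ECS2): `Λ` is a transversal of `E(R)` for the conjugation action of the unit group. -/
  transversal : ∀ e : R, IsIdempotentElem e →
    ∃! f : R, f ∈ Λ ∧ ∃ w : Rˣ, (w : R) * f * ((w⁻¹ : Rˣ) : R) = e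
  /-- (ECS4): comparable idempotents are simultaneously conjugate to a comparable pair in `Λ`. -/
  ecs4 : ∀ e₁ e₂ : R, IsIdempotentElem e₁ → IsIdempotentElem e₂ →
    e₁ * e₂ = e₁ → e₂ * e₁ = e₁ →
    ∃ (w : Rˣ) (f₁ f₂ : R), f₁ ∈ Λ ∧ f₂ ∈ Λ ∧ f₁ * f₂ = f₁ ∧ f₂ * f₁ = f₁ ∧
      (w : R) * f₁ * ((w⁻¹ : Rˣ) : R) = e₁ ∧ (w : R) * f₂ * ((w⁻¹ : Rˣ) : R) = e₂
  /-- (ECS5): `W(e)` is the standard parabolic subgroup on `λ(e)`. -/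
  mem_lam_iff : ∀ e ∈ Λ, ∀ w : Rˣ,
    ((w : R) * e = e * (w : R)) ↔ w ∈ Subgroup.closure (cs.simple '' lam e)
  /-- (ECS5): `W_⋆(e)` is the standard parabolic subgroup on `λ_⋆(e)`. -/
  mem_lamStar_iff : ∀ e ∈ Λ, ∀ w : Rˣ,
    ((w : R) * e = e ∧ e * (w : R) = e) ↔ w ∈ Subgroup.closure (cs.simple '' lamStar e)
  /-- (ECS6): the map `e ↦ λ^⋆(e)` is order preserving. -/
  ecs6 : ∀ e ∈ Λ, ∀ f ∈ Λ, e * f = e →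
    ∀ s : B, ((cs.simple s : R) * e = e * (cs.simple s : R) ∧ (cs.simple s : R) * e ≠ e) →
      ((cs.simple s : R) * f = f * (cs.simple s : R) ∧ (cs.simple s : R) * f ≠ f)

namespace GRCSystem

variable {B R : Type*} [Monoid R] (G : GRCSystem B R)

/-- The standard parabolic subgroup `W_I` of the unit group of `R`. -/
def parab (I : Set B) : Subgroup Rˣ := Subgroup.closure (G.cs.simple '' I)

/-- The set `λ^⋆(e) = {s ∈ S : s e = e s ≠ e}`. -/
def lamCostar (e : R) : Set B :=
  {s : B | (G.cs.simple s : R) * e = e * (G.cs.simple s : R) ∧ (G.cs.simple s : R) * e ≠ e}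

/-- Value in `R` of a letter of the alphabet `S ⊔ R`. -/
def letterVal : B ⊕ R → R := Sum.elim (fun s => ((G.cs.simple s : Rˣ) : R)) id

/-- A word on the alphabet `S ∪ (Λ ∖ {1})`: every `inr` letter is a nonidentity element of `Λ`. -/
def IsWord (l : List (B ⊕ R)) : Prop := ∀ e : R, Sum.inr e ∈ l → e ∈ G.Λ ∧ e ≠ 1

/-- The length of a word: letters from `S` count 1, letters from `Λ` count 0. -/
def wordLen (l : List (B ⊕ R)) : ℕ := (l.filter Sum.isLeft).length

/-- The length `ℓ(r)`: the minimal length of a word on `S ∪ (Λ ∖ {1})` representing `r`. -/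
def len (r : R) : ℕ :=
  sInf {n : ℕ | ∃ l : List (B ⊕ R), G.IsWord l ∧ (l.map G.letterVal).prod = r ∧ n = wordLen l}

/-- `(w₁, e, w₂)` is the normal decomposition of `r`: `e ∈ Λ`, `w₁` is `(∅, λ_⋆(e))`-reduced
(minimal length in `w₁ W_{λ_⋆(e)}`), `w₂` is `(λ(e), ∅)`-reduced (minimal length in
`W_{λ(e)} w₂`), and `r = w₁ e w₂`. -/
def IsNormalDecomp (r : R) (w₁ : Rˣ) (e : R) (w₂ : Rˣ) : Prop :=
  e ∈ G.Λ ∧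
  (∀ u ∈ G.parab (G.lamStar e), G.cs.length w₁ ≤ G.cs.length (w₁ * u)) ∧
  (∀ u ∈ G.parab (G.lam e), G.cs.length w₂ ≤ G.cs.length (u * w₂)) ∧
  r = (w₁ : R) * e * (w₂ : R)

/-- `w` is `(I,J)`-reduced: `w` has minimal length in the double coset `W_I w W_J`. -/
def IsRed (I J : Set B) (w : Rˣ) : Prop :=
  ∀ u ∈ G.parab I, ∀ v ∈ G.parab J, G.cs.length w ≤ G.cs.length (u * w * v)

end GRCSystem

namespace CoxeterSystem

variable {B W : Type*} [Group W] {M : CoxeterMatrix B} (cs : CoxeterSystem M W)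

/-- Conjugation by `s i` on the first component, flipping the sign in the second component when
the first one is `s i` itself. -/
def signedConj (i : B) : Function.End (W × ZMod 2) := by
  classical
  exact fun p => (cs.simple i * p.1 * cs.simple i, p.2 + if p.1 = cs.simple i then 1 else 0)

theorem signedConj_mul_pow (i j : B) (m : ℕ) (t : W) (z : ZMod 2) [DecidableEq W] :
    ((cs.signedConj i * cs.signedConj j) ^ m) (t, z) =
      ((cs.simple i * cs.simple j) ^ m * t * ((cs.simple i * cs.simple j) ^ m)⁻¹,
        z + ∑ n ∈ Finset.range (2 * m),
          if t = ((cs.simple i * cs.simple j) ^ n)⁻¹ * cs.simple j then 1 else 0) := by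
  induction m with
  | zero => simp [Function.End.one_def]
  | succ m ih =>
    rw [pow_succ']
    change (cs.signedConj i * cs.signedConj j) (((cs.signedConj i * cs.signedConj j) ^ m) (t, z)) = _
    rw [ih]
    set r := cs.simple i * cs.simple j with hr
    have hsr : cs.simple j * r = r⁻¹ * cs.simple j := by
      simp [hr, mul_assoc]
    have hsrn : ∀ n : ℕ, cs.simple j * r ^ n = (r ^ n)⁻¹ * cs.simple j := by
      intro n
      induction n with
      | zero => simp
      | succ n ihn =>
        rw [pow_succ, ← mul_assoc, ihn, mul_assoc, hsr, ← mul_assoc, ← mul_inv_rev, ← pow_succ',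
          pow_succ]
    have e1 : r ^ m * t * (r ^ m)⁻¹ = cs.simple j ↔ t = (r ^ (2 * m))⁻¹ * cs.simple j := by
      rw [mul_inv_eq_iff_eq_mul, hsrn, ← eq_inv_mul_iff_mul_eq, ← mul_assoc, ← mul_inv_rev,
        ← pow_add, two_mul]
    have e2 : cs.simple j * (r ^ m * t * (r ^ m)⁻¹) * cs.simple j = cs.simple i ↔
        t = (r ^ (2 * m + 1))⁻¹ * cs.simple j := by
      have h1 : cs.simple j * (r ^ m * t * (r ^ m)⁻¹) * cs.simple j = cs.simple i ↔
          r ^ m * t * (r ^ m)⁻¹ = cs.simple j * cs.simple i * cs.simple j := by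
        constructor
        · intro h
          rw [← h]; simp [mul_assoc]
        · intro h
          rw [h]; simp [mul_assoc]
      have h2 : cs.simple j * cs.simple i = r⁻¹ := by simp [hr]
      rw [h1, h2, mul_inv_eq_iff_eq_mul, mul_assoc, hsrn, ← eq_inv_mul_iff_mul_eq]
      simp only [← mul_assoc, ← mul_inv_rev]
      rw [← pow_succ, ← pow_add, show m + 1 + m = 2 * m + 1 by ring]
    have key : (cs.signedConj i * cs.signedConj j)
        (r ^ m * t * (r ^ m)⁻¹, z + ∑ n ∈ Finset.range (2 * m),
          if t = (r ^ n)⁻¹ * cs.simple j then (1 : ZMod 2) else 0) =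
        (cs.simple i * (cs.simple j * (r ^ m * t * (r ^ m)⁻¹) * cs.simple j) * cs.simple i,
          z + (∑ n ∈ Finset.range (2 * m),
          if t = (r ^ n)⁻¹ * cs.simple j then (1 : ZMod 2) else 0) +
          (if r ^ m * t * (r ^ m)⁻¹ = cs.simple j then 1 else 0) +
          (if cs.simple j * (r ^ m * t * (r ^ m)⁻¹) * cs.simple j = cs.simple i
            then 1 else 0)) := by
      simp only [Function.End.mul_def, Function.comp, signedConj]
      congr
    rw [key, show 2 * (m + 1) = 2 * m + 1 + 1 by ring, Finset.sum_range_succ,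
      Finset.sum_range_succ]
    simp only [e1, e2]
    refine Prod.ext ?_ (by simp only [add_assoc])
    rw [pow_succ' r m, mul_inv_rev]
    simp only [hr, mul_inv_rev, cs.inv_simple, mul_assoc]

theorem isLiftable_signedConj : M.IsLiftable cs.signedConj := by
  classical
  intro i j
  funext ⟨t, z⟩
  rw [signedConj_mul_pow, cs.simple_mul_simple_pow, two_mul, Finset.sum_range_add]
  simp only [pow_add, cs.simple_mul_simple_pow, one_mul, CharTwo.add_self_eq_zero]
  simp [Function.End.one_def]

/-- The action of `W` on `W × ZMod 2` by signed conjugation. -/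
def signedConjHom : W →* Function.End (W × ZMod 2) :=
  cs.lift ⟨cs.signedConj, cs.isLiftable_signedConj⟩

theorem signedConjHom_simple (i : B) : cs.signedConjHom (cs.simple i) = cs.signedConj i :=
  cs.lift_apply_simple cs.isLiftable_signedConj i

theorem signedConjHom_wordProd [DecidableEq W] (ω : List B) (t : W) (z : ZMod 2) :
    cs.signedConjHom (cs.wordProd ω) (t, z) =
      (cs.wordProd ω * t * (cs.wordProd ω)⁻¹, z + (cs.rightInvSeq ω).count t) := by
  induction ω with
  | nil => simp [Function.End.one_def]
  | cons i ω ih =>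
    rw [cs.wordProd_cons, map_mul, cs.signedConjHom_simple]
    change cs.signedConj i (cs.signedConjHom (cs.wordProd ω) (t, z)) = _
    rw [ih]
    have e : cs.wordProd ω * t * (cs.wordProd ω)⁻¹ = cs.simple i ↔
        (cs.wordProd ω)⁻¹ * cs.simple i * cs.wordProd ω = t := by
      rw [mul_inv_eq_iff_eq_mul, ← eq_inv_mul_iff_mul_eq, mul_assoc, eq_comm]
    refine Prod.ext ?_ ?_
    · simp [signedConj, mul_assoc]
    · simp only [signedConj, e, rightInvSeq, List.count_cons, beq_iff_eq, Nat.cast_add,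
        Nat.cast_ite, Nat.cast_one, Nat.cast_zero, add_assoc]

/-- The exchange condition. -/
theorem exists_eraseIdx_of_length_lt (ω : List B) (i : B)
    (h : cs.length (cs.simple i * cs.wordProd ω) < cs.length (cs.wordProd ω)) :
    ∃ j < ω.length, cs.simple i * cs.wordProd ω = cs.wordProd (ω.eraseIdx j) := by
  classical
  have mem_of : ∀ ω : List B, (cs.signedConjHom (cs.wordProd ω)⁻¹ (cs.simple i, 0)).2 = 1 →
      cs.simple i ∈ cs.leftInvSeq ω := by
    intro ω hω
    rw [← cs.wordProd_reverse, cs.signedConjHom_wordProd, cs.rightInvSeq_reverse,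
      List.count_reverse, zero_add] at hω
    by_contra hn
    rw [List.count_eq_zero_of_not_mem hn] at hω
    simp at hω
  have hmem : cs.simple i ∈ cs.leftInvSeq ω := by
    apply mem_of
    by_contra hne
    have h0 : (cs.signedConjHom (cs.wordProd ω)⁻¹ (cs.simple i, 0)).2 = 0 := by
      generalize (cs.signedConjHom (cs.wordProd ω)⁻¹ (cs.simple i, 0)).2 = z at hne
      revert z; decide
    obtain ⟨ω', hω', hprod⟩ := cs.exists_isReduced (cs.simple i * cs.wordProd ω)
    have h1 : (cs.signedConjHom (cs.wordProd ω')⁻¹ (cs.simple i, 0)).2 = 1 := by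
      rw [← hprod, mul_inv_rev, map_mul, cs.inv_simple, cs.signedConjHom_simple]
      change (cs.signedConjHom (cs.wordProd ω)⁻¹ (cs.signedConj i (cs.simple i, 0))).2 = 1
      have : cs.signedConj i (cs.simple i, 0) = (cs.simple i, 1) := by simp [signedConj]
      rw [this]
      rw [← cs.wordProd_reverse, cs.signedConjHom_wordProd] at h0 ⊢
      simp only [zero_add] at h0
      simp [h0]
    have h2 := (cs.isLeftInversion_of_mem_leftInvSeq hω' (mem_of ω' h1)).2
    rw [← hprod, cs.simple_mul_simple_cancel_left] at h2
    omega
  obtain ⟨j, hj, hij⟩ := List.mem_iff_getElem.mp hmem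
  refine ⟨j, by simpa using hj, ?_⟩
  rw [← cs.getD_leftInvSeq_mul_wordProd, List.getD_eq_getElem _ _ hj, hij]

theorem wordProd_mem_closure {I : Set B} {ω : List B} (h : ∀ i ∈ ω, i ∈ I) :
    cs.wordProd ω ∈ Subgroup.closure (cs.simple '' I) :=
  Subgroup.list_prod_mem _ fun x hx => by
    obtain ⟨i, hi, rfl⟩ := List.mem_map.mp hx
    exact Subgroup.subset_closure ⟨i, h i hi, rfl⟩

theorem exists_isReduced_of_mem_closure {I : Set B} {u : W}
    (hu : u ∈ Subgroup.closure (cs.simple '' I)) :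
    ∃ ω : List B, (∀ i ∈ ω, i ∈ I) ∧ cs.IsReduced ω ∧ u = cs.wordProd ω := by
  have step : ∀ i ∈ I, ∀ u : W,
      (∃ ω : List B, (∀ i ∈ ω, i ∈ I) ∧ cs.IsReduced ω ∧ u = cs.wordProd ω) →
      ∃ ω : List B, (∀ i ∈ ω, i ∈ I) ∧ cs.IsReduced ω ∧ cs.simple i * u = cs.wordProd ω := by
    rintro i hi u ⟨ω, hω, hr, rfl⟩
    rcases cs.length_simple_mul (cs.wordProd ω) i with hl | hl
    · refine ⟨i :: ω, by simpa [hi] using hω, ?_, by rw [cs.wordProd_cons]⟩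
      rw [IsReduced, cs.wordProd_cons, hl, hr.eq, List.length_cons]
    · obtain ⟨j, hj, he⟩ := cs.exists_eraseIdx_of_length_lt ω i (by omega)
      refine ⟨ω.eraseIdx j, fun k hk => hω k (List.mem_of_mem_eraseIdx hk), ?_, he⟩
      have := hr.eq
      rw [IsReduced, ← he, List.length_eraseIdx_of_lt hj]
      omega
  induction hu using Subgroup.closure_induction_left with
  | one => exact ⟨[], by simp, by simp [IsReduced], by simp⟩
  | mul_left x hx y hy ih =>
    obtain ⟨i, hi, rfl⟩ := hx
    exact step i hi y ih
  | inv_mul_cancel x hx y hy ih =>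
    obtain ⟨i, hi, rfl⟩ := hx
    rw [cs.inv_simple]
    exact step i hi y ih

theorem simple_mul_mem_closure_of_length_lt {K : Set B} {t : W}
    (ht : t ∈ Subgroup.closure (cs.simple '' K)) {i : B}
    (h : cs.length (cs.simple i * t) < cs.length t) :
    cs.simple i * t ∈ Subgroup.closure (cs.simple '' K) := by
  obtain ⟨ω, hω, -, rfl⟩ := cs.exists_isReduced_of_mem_closure ht
  obtain ⟨j, -, he⟩ := cs.exists_eraseIdx_of_length_lt ω i h
  rw [he]
  exact cs.wordProd_mem_closure fun k hk => hω k (List.mem_of_mem_eraseIdx hk)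

/-- `w` has minimal length in the coset `W_I w`. -/
def IsLeftMin (I : Set B) (w : W) : Prop :=
  ∀ u ∈ Subgroup.closure (cs.simple '' I), cs.length w ≤ cs.length (u * w)

theorem exists_isLeftMin (I : Set B) (w : W) :
    ∃ u ∈ Subgroup.closure (cs.simple '' I), cs.IsLeftMin I (u * w) := by
  obtain ⟨u, hu, hmin⟩ := exists_minimalFor_of_wellFoundedLT
    (fun u => u ∈ Subgroup.closure (cs.simple '' I)) (fun u => cs.length (u * w))
    ⟨1, one_mem _⟩
  refine ⟨u, hu, fun v hv => ?_⟩
  rw [← mul_assoc]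
  by_contra! hlt
  exact absurd (hmin (mul_mem hv hu) hlt.le) (by simpa using hlt)

variable {cs}

theorem eraseIdx_append_cases (ω ω' : List B) {j : ℕ} (hj : j < (ω ++ ω').length) :
    (∃ k < ω.length, (ω ++ ω').eraseIdx j = ω.eraseIdx k ++ ω') ∨
      ∃ k < ω'.length, (ω ++ ω').eraseIdx j = ω ++ ω'.eraseIdx k := by
  rcases lt_or_ge j ω.length with h | h
  · exact .inl ⟨j, h, List.eraseIdx_append_of_lt_length h _⟩
  · rw [List.length_append] at hj
    exact .inr ⟨j - ω.length, by omega, List.eraseIdx_append_of_length_le h _⟩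

theorem IsLeftMin.length_mul {I : Set B} {w : W} (hw : cs.IsLeftMin I w) {u : W}
    (hu : u ∈ Subgroup.closure (cs.simple '' I)) :
    cs.length (u * w) = cs.length u + cs.length w := by
  obtain ⟨ω, hω, hr, rfl⟩ := cs.exists_isReduced_of_mem_closure hu
  clear hu
  induction ω with
  | nil => simp
  | cons i ω ih =>
    have hr' : cs.IsReduced ω := by simpa using hr.drop 1
    have hω' : ∀ k ∈ ω, k ∈ I := fun k hk => hω k (List.mem_cons_of_mem _ hk)
    have ih := ih hω' hr'
    obtain ⟨ω₂, hr₂, rfl⟩ := cs.exists_isReduced w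
    have e1 := hr.eq
    have e2 := hr'.eq
    have e3 := hr₂.eq
    rw [List.length_cons] at e1
    rw [cs.wordProd_cons, mul_assoc] at *
    rcases cs.length_simple_mul (cs.wordProd ω * cs.wordProd ω₂) i with hl | hl
    · omega
    · exfalso
      rw [← cs.wordProd_append] at hl
      obtain ⟨j, hj, he⟩ := cs.exists_eraseIdx_of_length_lt (ω ++ ω₂) i (by omega)
      rcases eraseIdx_append_cases ω ω₂ hj with ⟨k, hk, h⟩ | ⟨k, hk, h⟩
      · rw [h, cs.wordProd_append, cs.wordProd_append, ← mul_assoc, mul_left_inj] at he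
        have := cs.length_wordProd_le (ω.eraseIdx k)
        rw [List.length_eraseIdx_of_lt hk, ← he] at this
        omega
      · rw [h, cs.wordProd_append, cs.wordProd_append] at he
        have hmem : (cs.wordProd ω)⁻¹ * cs.simple i * cs.wordProd ω ∈
            Subgroup.closure (cs.simple '' I) :=
          have hp := cs.wordProd_mem_closure hω'
          mul_mem (mul_mem (inv_mem hp)
            (Subgroup.subset_closure ⟨i, hω i List.mem_cons_self, rfl⟩)) hp
        have h1 := hw _ hmem
        have h2 := cs.length_wordProd_le (ω₂.eraseIdx k)
        rw [mul_assoc, mul_assoc, he, inv_mul_cancel_left] at h1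
        rw [List.length_eraseIdx_of_lt hk] at h2
        omega

theorem IsLeftMin.length_mul_right {J : Set B} {w : W} (hw : cs.IsLeftMin J w⁻¹) {v : W}
    (hv : v ∈ Subgroup.closure (cs.simple '' J)) :
    cs.length (w * v) = cs.length w + cs.length v := by
  have := hw.length_mul (inv_mem hv)
  rwa [← mul_inv_rev, cs.length_inv, cs.length_inv, cs.length_inv, add_comm] at this

theorem exists_length_lt_of_not_isLeftMin {I : Set B} {w : W} (hw : ¬ cs.IsLeftMin I w) :
    ∃ i ∈ I, cs.length (cs.simple i * w) < cs.length w := by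
  obtain ⟨u, hu, hmin⟩ := cs.exists_isLeftMin I w
  obtain ⟨ω, hω, hr, he⟩ := cs.exists_isReduced_of_mem_closure (inv_mem hu)
  have hwu : w = cs.wordProd ω * (u * w) := by rw [← he, inv_mul_cancel_left]
  cases ω with
  | nil =>
    rw [cs.wordProd_nil, inv_eq_one] at he
    rw [he, one_mul] at hmin
    exact absurd hmin hw
  | cons i ω =>
    refine ⟨i, hω i List.mem_cons_self, ?_⟩
    have h1 := hmin.length_mul (cs.wordProd_mem_closure hω)
    rw [← hwu, hr.eq, List.length_cons] at h1
    have h2 : cs.simple i * w = cs.wordProd ω * (u * w) := by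
      conv_lhs => rw [hwu, cs.wordProd_cons, mul_assoc, cs.simple_mul_simple_cancel_left]
    have h3 := cs.length_mul_le (cs.wordProd ω) (u * w)
    have h4 := cs.length_wordProd_le ω
    rw [h2]
    omega

/-- A double coset `W_I t W_J` contains at most one element which is minimal on both sides. -/
theorem IsLeftMin.eq_of_mul_eq_mul {I J : Set B} {a t : W}
    (ha : cs.IsLeftMin I a) (ha' : cs.IsLeftMin J a⁻¹)
    (ht : cs.IsLeftMin I t) (ht' : cs.IsLeftMin J t⁻¹) {w v : W}
    (hw : w ∈ Subgroup.closure (cs.simple '' I)) (hv : v ∈ Subgroup.closure (cs.simple '' J))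
    (h : a * v = w * t) : a = t := by
  obtain ⟨ω, hω, hr, rfl⟩ := cs.exists_isReduced_of_mem_closure hw
  clear hw
  induction ω generalizing v with
  | nil =>
    rw [cs.wordProd_nil, one_mul] at h
    have h1 := ha'.length_mul_right hv
    have h2 := ht'.length_mul_right (inv_mem hv)
    rw [h] at h1
    rw [← h, mul_inv_cancel_right, cs.length_inv, h] at h2
    have h3 : v = 1 := cs.length_eq_zero_iff.mp (by omega)
    rw [← h, h3, mul_one]
  | cons i ω ih =>
    have hr' : cs.IsReduced ω := by simpa using hr.drop 1
    have hω' : ∀ k ∈ ω, k ∈ I := fun k hk => hω k (List.mem_cons_of_mem _ hk)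
    obtain ⟨ωa, hra, hea⟩ := cs.exists_isReduced a
    obtain ⟨ωv, hωv, hrv, hev⟩ := cs.exists_isReduced_of_mem_closure hv
    have hs : cs.simple i * (a * v) = cs.wordProd ω * t := by
      rw [h, cs.wordProd_cons, mul_assoc, cs.simple_mul_simple_cancel_left]
    have hlt : cs.length (cs.simple i * (a * v)) < cs.length (a * v) := by
      rw [hs, h, ht.length_mul (cs.wordProd_mem_closure hω), hr.eq,
        ht.length_mul (cs.wordProd_mem_closure hω'), hr'.eq, List.length_cons]
      omega
    have hav : a * v = cs.wordProd (ωa ++ ωv) := by rw [cs.wordProd_append, ← hea, ← hev]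
    rw [hav] at hlt
    obtain ⟨j, hj, he⟩ := cs.exists_eraseIdx_of_length_lt _ i hlt
    rcases eraseIdx_append_cases ωa ωv hj with ⟨k, hk, hk'⟩ | ⟨k, hk, hk'⟩
    · exfalso
      rw [hk', cs.wordProd_append, cs.wordProd_append, ← mul_assoc, mul_left_inj, ← hea] at he
      have h1 := ha _ (Subgroup.subset_closure ⟨i, hω i List.mem_cons_self, rfl⟩)
      have h2 := cs.length_wordProd_le (ωa.eraseIdx k)
      rw [← he, List.length_eraseIdx_of_lt hk, ← hra.eq, ← hea] at h2
      have h3 := hra.eq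
      rw [← hea] at h3
      omega
    · rw [hk', ← hav, cs.wordProd_append, ← hea, hs] at he
      exact ih (cs.wordProd_mem_closure fun k hk => hωv k (List.mem_of_mem_eraseIdx hk))
        hω' hr' he.symm

variable (cs)

theorem exists_isLeftMin_isLeftMin_inv (I J K : Set B) {t : W}
    (ht : t ∈ Subgroup.closure (cs.simple '' K)) :
    ∃ x ∈ Subgroup.closure (cs.simple '' I), ∃ y ∈ Subgroup.closure (cs.simple '' J),
      x * t * y ∈ Subgroup.closure (cs.simple '' K) ∧
        cs.IsLeftMin I (x * t * y) ∧ cs.IsLeftMin J (x * t * y)⁻¹ := by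
  induction hn : cs.length t using Nat.strong_induction_on generalizing t with
  | _ n ih =>
    by_cases h1 : cs.IsLeftMin I t
    · by_cases h2 : cs.IsLeftMin J t⁻¹
      · exact ⟨1, one_mem _, 1, one_mem _, by simpa using ht, by simpa using h1,
          by simpa using h2⟩
      · obtain ⟨i, hi, hlt⟩ := exists_length_lt_of_not_isLeftMin h2
        have hmem := inv_mem (cs.simple_mul_mem_closure_of_length_lt (inv_mem ht) hlt)
        rw [mul_inv_rev, inv_inv, cs.inv_simple] at hmem
        rw [← cs.length_inv, mul_inv_rev, inv_inv, cs.inv_simple, cs.length_inv, hn] at hlt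
        obtain ⟨x, hx, y, hy, h⟩ := ih _ hlt hmem rfl
        refine ⟨x, hx, cs.simple i * y, mul_mem (Subgroup.subset_closure ⟨i, hi, rfl⟩) hy, ?_⟩
        simpa only [mul_assoc] using h
    · obtain ⟨i, hi, hlt⟩ := exists_length_lt_of_not_isLeftMin h1
      obtain ⟨x, hx, y, hy, h⟩ :=
        ih _ (hn ▸ hlt) (cs.simple_mul_mem_closure_of_length_lt ht hlt) rfl
      refine ⟨x * cs.simple i, mul_mem hx (Subgroup.subset_closure ⟨i, hi, rfl⟩), y, hy, ?_⟩
      simpa only [mul_assoc] using h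

end CoxeterSystem

namespace GRCSystem

theorem wordLen_cons_inl {B R : Type*} (s : B) (l : List (B ⊕ R)) :
    wordLen (Sum.inl s :: l) = wordLen l + 1 := by
  rw [wordLen, List.filter_cons_of_pos rfl, List.length_cons, wordLen]

theorem wordLen_cons_inr {B R : Type*} (e : R) (l : List (B ⊕ R)) :
    wordLen (Sum.inr e :: l) = wordLen l := by
  simp [wordLen]

variable {B R : Type*} [Monoid R]

theorem isIdempotentElem_conj {e : R} (he : IsIdempotentElem e) (a : Rˣ) :
    IsIdempotentElem ((a : R) * e * ((a⁻¹ : Rˣ) : R)) := by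
  unfold IsIdempotentElem
  simp only [mul_assoc, Units.inv_mul_cancel_left]
  rw [← mul_assoc e e, he.eq]

theorem eq_of_mul_unit_eq_mul_unit (G : GRCSystem B R) {p q : R} (hp : IsIdempotentElem p)
    (hq : IsIdempotentElem q) {u v : Rˣ} (h : p * u = q * v) : p = q := by
  have key : ∀ {p q : R} {u v : Rˣ}, IsIdempotentElem q → p * u = q * v → q * p = p := by
    intro p q u v hq h
    rw [← Units.eq_mul_inv_iff_mul_eq] at h
    rw [h, ← mul_assoc, ← mul_assoc, hq.eq]
  rw [← key hq h, G.idem_mul_comm q p hq hp, key hp h.symm]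

theorem eq_of_unit_mul_eq_unit_mul (G : GRCSystem B R) {p q : R} (hp : IsIdempotentElem p)
    (hq : IsIdempotentElem q) {u v : Rˣ} (h : u * p = v * q) : p = q := by
  have key : ∀ {p q : R} {u v : Rˣ}, IsIdempotentElem q → u * p = v * q → p * q = p := by
    intro p q u v hq h
    rw [← Units.eq_inv_mul_iff_mul_eq] at h
    rw [h, mul_assoc, mul_assoc, hq.eq]
  rw [← key hq h, G.idem_mul_comm p q hp hq, key hp h.symm]

theorem inv_mul_comm_of_conj_eq_conj {e : R} {a b : Rˣ}
    (h : (a : R) * e * ((a⁻¹ : Rˣ) : R) = b * e * ((b⁻¹ : Rˣ) : R)) :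
    ((a⁻¹ * b : Rˣ) : R) * e = e * ((a⁻¹ * b : Rˣ) : R) := by
  rw [Units.mul_inv_eq_iff_eq_mul] at h
  rw [Units.val_mul, mul_assoc, Units.inv_mul_eq_iff_eq_mul, ← mul_assoc,
    ← mul_assoc, h]
  simp [mul_assoc]

variable (G : GRCSystem B R)

theorem eq_of_conj_eq_conj {e f : R} (he : e ∈ G.Λ) (hf : f ∈ G.Λ) {a b : Rˣ}
    (h : (a : R) * e * ((a⁻¹ : Rˣ) : R) = b * f * ((b⁻¹ : Rˣ) : R)) : e = f :=
  (G.transversal _ (isIdempotentElem_conj (G.lam_idem f hf) b)).unique ⟨he, a, h⟩ ⟨hf, b, rfl⟩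

theorem eq_of_conj_eq {e f : R} (he : e ∈ G.Λ) (hf : f ∈ G.Λ) {a : Rˣ}
    (h : (a : R) * e * ((a⁻¹ : Rˣ) : R) = f) : e = f :=
  G.eq_of_conj_eq_conj he hf (a := a) (b := 1) (by simpa using h)

theorem one_mem_Λ : (1 : R) ∈ G.Λ := by
  obtain ⟨f, ⟨hf, w, hw⟩, -⟩ := G.transversal 1 (mul_one 1)
  rw [Units.mul_inv_eq_iff_eq_mul, one_mul] at hw
  have : f = 1 := w.isUnit.mul_left_cancel (by rw [hw, mul_one])
  rwa [← this]

theorem simple_mul_comm_of_mem_lam {e : R} (he : e ∈ G.Λ) {s : B} (hs : s ∈ G.lam e) :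
    (G.cs.simple s : R) * e = e * G.cs.simple s :=
  (G.mem_lam_iff e he _).mpr (Subgroup.subset_closure ⟨s, hs, rfl⟩)

/-- If an idempotent lies below `f ∈ Λ`, it is conjugate to an element of `Λ` by an element
of `W(f)`. -/
theorem exists_conj_of_mul_eq {f p : R} (hf : f ∈ G.Λ) (hp : IsIdempotentElem p)
    (hpf : p * f = p) :
    ∃ g ∈ G.Λ, g * f = g ∧ ∃ w ∈ Subgroup.closure (G.cs.simple '' G.lam f),
      (w : R) * g * ((w⁻¹ : Rˣ) : R) = p := by
  have hfi := G.lam_idem f hf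
  obtain ⟨w, f₁, f₂, hf₁, hf₂, h12, -, hw₁, hw₂⟩ :=
    G.ecs4 p f hp hfi hpf (by rw [G.idem_mul_comm f p hfi hp, hpf])
  obtain rfl := G.eq_of_conj_eq hf₂ hf hw₂
  refine ⟨f₁, hf₁, h12, w, ?_, hw₁⟩
  rw [← G.mem_lam_iff f₂ hf]
  rwa [Units.mul_inv_eq_iff_eq_mul] at hw₂

theorem closure_lamCostar_le {g f : R} (hg : g ∈ G.Λ) (hf : f ∈ G.Λ) (hgf : g * f = g) :
    Subgroup.closure (G.cs.simple '' G.lamCostar g) ≤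
      Subgroup.closure (G.cs.simple '' G.lam f) := by
  rw [Subgroup.closure_le]
  rintro _ ⟨s, hs, rfl⟩
  exact (G.mem_lam_iff f hf _).mp (G.ecs6 g hg f hf hgf s hs).1

/-- `W(g)` is generated by `W_⋆(g)` and `λ^⋆(g)`. -/
theorem exists_eq_mul_of_mem_closure_lam {g : R} (hg : g ∈ G.Λ) {t : Rˣ}
    (ht : t ∈ Subgroup.closure (G.cs.simple '' G.lam g)) :
    ∃ t₂ ∈ Subgroup.closure (G.cs.simple '' G.lamCostar g),
      ∃ t₁ ∈ Subgroup.closure (G.cs.simple '' G.lamStar g), t = t₂ * t₁ := by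
  have step : ∀ s ∈ G.lam g, ∀ t : Rˣ,
      (∃ t₂ ∈ Subgroup.closure (G.cs.simple '' G.lamCostar g),
        ∃ t₁ ∈ Subgroup.closure (G.cs.simple '' G.lamStar g), t = t₂ * t₁) →
      ∃ t₂ ∈ Subgroup.closure (G.cs.simple '' G.lamCostar g),
        ∃ t₁ ∈ Subgroup.closure (G.cs.simple '' G.lamStar g), G.cs.simple s * t = t₂ * t₁ := by
    rintro s hs t ⟨t₂, ht₂, t₁, ht₁, rfl⟩
    have hc := G.simple_mul_comm_of_mem_lam hg hs
    by_cases hsg : (G.cs.simple s : R) * g = g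
    · refine ⟨t₂, ht₂, (t₂⁻¹ * G.cs.simple s * t₂) * t₁, mul_mem ?_ ht₁, by group⟩
      rw [← G.mem_lamStar_iff g hg]
      have hle := G.closure_lamCostar_le hg hg (G.lam_idem g hg)
      have h1 := (G.mem_lam_iff g hg _).mpr (hle ht₂)
      have h2 := (G.mem_lam_iff g hg _).mpr (hle (inv_mem ht₂))
      constructor
      · rw [Units.val_mul, Units.val_mul, mul_assoc, h1, mul_assoc, ← mul_assoc _ g, hsg, ← h1,
          Units.inv_mul_cancel_left]
      · rw [Units.val_mul, Units.val_mul, ← mul_assoc, ← mul_assoc, ← h2, mul_assoc _ g, ← hc,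
          hsg, h2, Units.inv_mul_cancel_right]
    · exact ⟨G.cs.simple s * t₂, mul_mem (Subgroup.subset_closure ⟨s, ⟨hc, hsg⟩, rfl⟩) ht₂,
        t₁, ht₁, by rw [mul_assoc]⟩
  induction ht using Subgroup.closure_induction_left with
  | one => exact ⟨1, one_mem _, 1, one_mem _, by simp⟩
  | mul_left x hx y hy ih =>
    obtain ⟨s, hs, rfl⟩ := hx
    exact step s hs y ih
  | inv_mul_cancel x hx y hy ih =>
    obtain ⟨s, hs, rfl⟩ := hx
    rw [G.cs.inv_simple]
    exact step s hs y ih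

/-- Sandwiching a doubly reduced unit between two elements of `Λ` gives an element of `Λ`. -/
theorem mul_unit_mul_mem_Λ {f e : R} (hf : f ∈ G.Λ) (he : e ∈ G.Λ) {a : Rˣ}
    (hl : G.cs.IsLeftMin (G.lam f) a) (hr : G.cs.IsLeftMin (G.lam e) a⁻¹) :
    f * a * e ∈ G.Λ := by
  have hfi := G.lam_idem f hf
  have hei := G.lam_idem e he
  set q : R := (a : R) * e * ((a⁻¹ : Rˣ) : R) with hq
  have hqi : IsIdempotentElem q := isIdempotentElem_conj hei a
  have hfq := G.idem_mul_comm f q hfi hqi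
  set p : R := f * q with hp
  have hpi : IsIdempotentElem p := hfi.mul_of_commute hfq hqi
  have hpf : p * f = p := by rw [hfq, mul_assoc, hfi.eq]
  have hpa : p * a = f * a * e := by simp [hp, hq, mul_assoc]
  have hpi' : IsIdempotentElem (((a⁻¹ : Rˣ) : R) * p * a) := by
    simpa using isIdempotentElem_conj hpi a⁻¹
  have hpe : ((a⁻¹ : Rˣ) : R) * p * a * e = ((a⁻¹ : Rˣ) : R) * p * a := by
    rw [mul_assoc _ p, hpa]
    simp only [mul_assoc, hei.eq]
  obtain ⟨g, hg, hgf, w, hw, hwg⟩ := G.exists_conj_of_mul_eq hf hpi hpf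
  obtain ⟨g', hg', hge, v, hv, hvg⟩ := G.exists_conj_of_mul_eq he hpi' hpe
  have hvg' : ((a * v : Rˣ) : R) * g' * (((a * v)⁻¹ : Rˣ) : R) = p := by
    rw [mul_inv_rev, Units.val_mul, Units.val_mul]
    calc (a : R) * v * g' * (((v⁻¹ : Rˣ) : R) * ((a⁻¹ : Rˣ) : R))
        = a * (v * g' * ((v⁻¹ : Rˣ) : R)) * ((a⁻¹ : Rˣ) : R) := by simp only [mul_assoc]
      _ = p := by rw [hvg]; simp [mul_assoc]
  obtain rfl := G.eq_of_conj_eq_conj hg' hg (hvg'.trans hwg.symm)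
  have ht := (G.mem_lam_iff g' hg _).mp
    (inv_mul_comm_of_conj_eq_conj (hwg.trans hvg'.symm))
  obtain ⟨t₂, ht₂, t₁, ht₁, ht12⟩ := G.exists_eq_mul_of_mem_closure_lam hg ht
  obtain ⟨x, hx, y, hy, hxy, hxl, hyl⟩ :=
    G.cs.exists_isLeftMin_isLeftMin_inv (G.lam f) (G.lam e) (G.lamStar g') ht₁
  have ha : a = x * t₁ * y := by
    refine hl.eq_of_mul_eq_mul hr hxl hyl
      (mul_mem (mul_mem hw (G.closure_lamCostar_le hg hf hgf ht₂)) (inv_mem hx))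
      (mul_mem hv hy) ?_
    rw [inv_mul_eq_iff_eq_mul] at ht12
    rw [← mul_assoc, ht12]
    group
  rw [← ha, ← G.mem_lamStar_iff g' hg] at hxy
  obtain ⟨hag, hga⟩ := hxy
  have hgi := G.lam_idem g' hg
  have hag' : ((a⁻¹ : Rˣ) : R) * g' = g' := by rw [Units.inv_mul_eq_iff_eq_mul, hag]
  have hpg : p * g' = g' := by
    rw [hp, hq, mul_assoc, mul_assoc, hag', mul_assoc, G.idem_mul_comm e g' hei hgi, hge, hag,
      G.idem_mul_comm f g' hfi hgi, hgf]
  obtain ⟨u, f₁, f₂, hf₁, hf₂, -, -, hu₁, hu₂⟩ :=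
    G.ecs4 g' p hgi hpi (by rw [G.idem_mul_comm g' p hgi hpi, hpg]) hpg
  obtain rfl := G.eq_of_conj_eq hf₁ hg hu₁
  obtain rfl := G.eq_of_conj_eq_conj hf₂ hg (hu₂.trans hwg.symm)
  rw [← hpa, ← hu₂, hu₁, hga]
  exact hg

theorem simple_mul_simple_mul (s : B) (x : R) :
    (G.cs.simple s : R) * ((G.cs.simple s : R) * x) = x := by
  rw [← mul_assoc, ← Units.val_mul, G.cs.simple_mul_simple_self, Units.val_one, one_mul]

theorem exists_mul_unit_mul_eq {f e : R} (hf : f ∈ G.Λ) (he : e ∈ G.Λ) (a : Rˣ) :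
    ∃ (x y : Rˣ), ∃ g ∈ G.Λ, f * a * e = x * g * y ∧
      G.cs.length x + G.cs.length y ≤ G.cs.length a := by
  induction hn : G.cs.length a using Nat.strong_induction_on generalizing a with
  | _ n ih =>
    by_cases h1 : G.cs.IsLeftMin (G.lam f) a
    · by_cases h2 : G.cs.IsLeftMin (G.lam e) a⁻¹
      · exact ⟨1, 1, _, G.mul_unit_mul_mem_Λ hf he h1 h2, by simp, by simp⟩
      · obtain ⟨s, hs, hlt⟩ := CoxeterSystem.exists_length_lt_of_not_isLeftMin h2
        rw [← G.cs.length_inv, mul_inv_rev, inv_inv, G.cs.inv_simple, G.cs.length_inv, hn] at hlt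
        obtain ⟨x, y, g, hg, h, hle⟩ := ih _ hlt _ rfl
        refine ⟨x, y * G.cs.simple s, g, hg, ?_, ?_⟩
        · have hse := G.simple_mul_comm_of_mem_lam he hs
          rw [Units.val_mul, ← mul_assoc, ← h, mul_assoc _ e, ← hse]
          simp only [Units.val_mul, mul_assoc, G.simple_mul_simple_mul]
        · have := G.cs.length_mul_le y (G.cs.simple s)
          rw [G.cs.length_simple] at this
          omega
    · obtain ⟨s, hs, hlt⟩ := CoxeterSystem.exists_length_lt_of_not_isLeftMin h1
      obtain ⟨x, y, g, hg, h, hle⟩ := ih _ (hn ▸ hlt) _ rfl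
      refine ⟨G.cs.simple s * x, y, g, hg, ?_, ?_⟩
      · have hsf := G.simple_mul_comm_of_mem_lam hf hs
        calc f * a * e = f * (G.cs.simple s : R) * (((G.cs.simple s * a : Rˣ) : R) * e) := by
              simp only [Units.val_mul, mul_assoc, G.simple_mul_simple_mul]
          _ = (G.cs.simple s : R) * (f * ((G.cs.simple s * a : Rˣ) : R) * e) := by
              rw [← hsf]; simp only [mul_assoc]
          _ = ((G.cs.simple s * x : Rˣ) : R) * g * y := by
              rw [h]; simp only [Units.val_mul, mul_assoc]
      · have := G.cs.length_mul_le (G.cs.simple s) x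
        rw [G.cs.length_simple] at this
        omega

theorem exists_factor_length_le_wordLen {l : List (B ⊕ R)} (hl : G.IsWord l) :
    ∃ (a b : Rˣ), ∃ e ∈ G.Λ, (l.map G.letterVal).prod = a * e * b ∧
      G.cs.length a + G.cs.length b ≤ wordLen l := by
  induction l with
  | nil => exact ⟨1, 1, 1, G.one_mem_Λ, by simp, by simp⟩
  | cons c l ih =>
    obtain ⟨a, b, e, he, h, hle⟩ := ih fun e he => hl e (List.mem_cons_of_mem _ he)
    cases c with
    | inl s =>
      refine ⟨G.cs.simple s * a, b, e, he, ?_, ?_⟩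
      · rw [List.map_cons, List.prod_cons, h]
        simp [letterVal, mul_assoc]
      · have := G.cs.length_mul_le (G.cs.simple s) a
        rw [G.cs.length_simple] at this
        rw [wordLen_cons_inl]
        omega
    | inr f =>
      obtain ⟨x, y, g, hg, hxy, hle'⟩ :=
        G.exists_mul_unit_mul_eq (hl f List.mem_cons_self).1 he a
      refine ⟨x, y * b, g, hg, ?_, ?_⟩
      · rw [List.map_cons, List.prod_cons, h, Units.val_mul, ← mul_assoc _ (y : R), ← hxy]
        simp [letterVal, mul_assoc]
      · have := G.cs.length_mul_le y b
        rw [wordLen_cons_inr]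
        omega

variable {G}

theorem IsNormalDecomp.length_add_length_le {r : R} {w₁ w₂ : Rˣ} {e : R}
    (h : G.IsNormalDecomp r w₁ e w₂) {a b : Rˣ} {f : R} (hf : f ∈ G.Λ) (hr : r = a * f * b) :
    G.cs.length w₁ + G.cs.length w₂ ≤ G.cs.length a + G.cs.length b := by
  obtain ⟨he, h₁, h₂, h⟩ := h
  have hei := G.lam_idem e he
  have hfi := G.lam_idem f hf
  have hl : (w₁ : R) * e * ((w₁⁻¹ : Rˣ) : R) = a * f * ((a⁻¹ : Rˣ) : R) :=
    G.eq_of_mul_unit_eq_mul_unit (isIdempotentElem_conj hei w₁) (isIdempotentElem_conj hfi a)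
      (u := w₁ * w₂) (v := a * b) (by simpa [mul_assoc] using h.symm.trans hr)
  obtain rfl := G.eq_of_conj_eq_conj he hf hl
  have hri : ∀ w : Rˣ, IsIdempotentElem (((w⁻¹ : Rˣ) : R) * e * w) := fun w => by
    simpa using isIdempotentElem_conj hei w⁻¹
  have hrt : ((w₂⁻¹ : Rˣ) : R) * e * w₂ = ((b⁻¹ : Rˣ) : R) * e * b :=
    G.eq_of_unit_mul_eq_unit_mul (hri w₂) (hri b)
      (u := w₁ * w₂) (v := a * b) (by simpa [mul_assoc] using h.symm.trans hr)
  have hu : b * w₂⁻¹ ∈ Subgroup.closure (G.cs.simple '' G.lam e) := by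
    rw [← G.mem_lam_iff e he]
    simpa using inv_mul_comm_of_conj_eq_conj (a := b⁻¹) (b := w₂⁻¹) (by simpa using hrt.symm)
  have hb : G.cs.length b = G.cs.length (b * w₂⁻¹) + G.cs.length w₂ := by
    have hmin : G.cs.IsLeftMin (G.lam e) w₂ := h₂
    simpa using hmin.length_mul hu
  set u := b * w₂⁻¹ with hu_def
  have hue := (G.mem_lam_iff e he u).mpr hu
  have hcomm : ((w₁⁻¹ * (a * u) : Rˣ) : R) * e = e * ((w₁⁻¹ * (a * u) : Rˣ) : R) := by
    have := inv_mul_comm_of_conj_eq_conj hl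
    rw [← mul_assoc, Units.val_mul, mul_assoc, hue, ← mul_assoc, this, mul_assoc]
  have hfix : ((w₁⁻¹ * (a * u) : Rˣ) : R) * e = e := by
    have hb' : b = u * w₂ := by simp [hu_def]
    rw [h, hb', Units.val_mul, ← mul_assoc, Units.mul_left_inj, mul_assoc, ← hue] at hr
    rw [Units.val_mul, mul_assoc, Units.inv_mul_eq_iff_eq_mul, Units.val_mul, mul_assoc, hr]
  have hmem := (G.mem_lamStar_iff e he _).mp ⟨hfix, hcomm ▸ hfix⟩
  have h3 := h₁ _ hmem
  rw [mul_inv_cancel_left] at h3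
  have h4 := G.cs.length_mul_le a u
  omega

variable (G)

/-- The word on `S ∪ (Λ ∖ {1})` attached to a word on `B` has the same value. -/
theorem prod_map_inl (ω : List B) :
    ((ω.map Sum.inl).map G.letterVal).prod = ((G.cs.wordProd ω : Rˣ) : R) := by
  induction ω with
  | nil => simp
  | cons s ω ih =>
    rw [G.cs.wordProd_cons, Units.val_mul, ← ih]
    simp [letterVal]

theorem exists_isWord_of_mem_Λ {e : R} (he : e ∈ G.Λ) (w₁ w₂ : Rˣ) :
    ∃ l : List (B ⊕ R), G.IsWord l ∧ (l.map G.letterVal).prod = w₁ * e * w₂ ∧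
      wordLen l = G.cs.length w₁ + G.cs.length w₂ := by
  obtain ⟨ω₁, hr₁, rfl⟩ := G.cs.exists_isReduced w₁
  obtain ⟨ω₂, hr₂, rfl⟩ := G.cs.exists_isReduced w₂
  have hlen : ∀ ω : List B, ((ω.map (Sum.inl : B → B ⊕ R)).filter Sum.isLeft).length = ω.length :=
    fun ω => by rw [List.filter_eq_self.mpr (by simp), List.length_map]
  by_cases h1 : e = 1
  · refine ⟨ω₁.map Sum.inl ++ ω₂.map Sum.inl, by simp [IsWord], ?_, ?_⟩
    · rw [List.map_append, List.prod_append, prod_map_inl, prod_map_inl, h1, mul_one]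
    · rw [wordLen, List.filter_append, List.length_append, hlen, hlen, hr₁.eq, hr₂.eq]
  · refine ⟨ω₁.map Sum.inl ++ Sum.inr e :: ω₂.map Sum.inl, ?_, ?_, ?_⟩
    · intro f hf
      obtain rfl : f = e := by simpa using hf
      exact ⟨he, h1⟩
    · rw [List.map_append, List.prod_append, List.map_cons, List.prod_cons, prod_map_inl,
        prod_map_inl, mul_assoc]
      rfl
    · rw [wordLen, List.filter_append, List.length_append, List.filter_cons_of_neg (by simp),
        hlen, hlen, hr₁.eq, hr₂.eq]

end GRCSystem

/-- if `(w₁, e, w₂)` is the normal decomposition of `r`, then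
`ℓ(r) = ℓ(w₁) + ℓ(w₂)`, the right-hand lengths being Coxeter lengths in the unit group. -/
theorem len_eq_of_normal_decomposition
    {B R : Type*} [Monoid R] (G : GRCSystem B R)
    (r : R) (w₁ : Rˣ) (e : R) (w₂ : Rˣ)
    (h : G.IsNormalDecomp r w₁ e w₂) :
    G.len r = G.cs.length w₁ + G.cs.length w₂ := by
  obtain ⟨l, hl, hprod, hlen⟩ := G.exists_isWord_of_mem_Λ h.1 w₁ w₂
  refine le_antisymm (Nat.sInf_le ⟨l, hl, hprod.trans h.2.2.2.symm, hlen.symm⟩) ?_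
  refine le_csInf ⟨_, l, hl, hprod.trans h.2.2.2.symm, rfl⟩ ?_
  rintro _ ⟨l', hl', hr, rfl⟩
  obtain ⟨a, b, f, hf, hab, hle⟩ := G.exists_factor_length_le_wordLen hl'
  exact (h.length_add_length_le hf (hr.symm.trans hab)).trans hle
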